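/- arXiv:2011.10871 — 6 statements merged into one kernel-verified Lean document; each statement's English description precedes it below -/
import Mathlib

section
/- Let K be a field, S = K[x_0,…,x_n] a polynomial ring, and let q_1,…,q_a ∈ S be K-linearly independent quadrics (homogeneous polynomials of degree 2). Suppose V_1, V_2 ∈ (S_1)^a are K-linearly independent linear syzygies on (q_1,…,q_a), i.e. Σ_{i=1}^a V_k(i)·q_i = 0 for k = 1,2. Then the only linear forms L_1, L_2 ∈ S_1 with L_1·V_1 + L_2·V_2 = 0 (componentwise) are L_1 = L_2 = 0. In particular, an ideal generated by linearly independent quadrics cannot have exactly two independent linear first syzygies together with a nonzero linear second syzygy among them (v ≠ (2,1)). -/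
open MvPolynomial

lemma aux_const {K : Type*} [Field K] {n : ℕ} {L P Q : MvPolynomial (Fin (n + 1)) K}
    (hL : L.IsHomogeneous 1) (hP : P.IsHomogeneous 1) (hL0 : L ≠ 0)
    (h : P = L * Q) : ∃ c : K, Q = C c := by
  by_cases hQ : Q = 0
  · exact ⟨0, by simp [hQ]⟩
  have hP0 : P ≠ 0 := by rw [h]; exact mul_ne_zero hL0 hQ
  have h1 := totalDegree_mul_of_isDomain hL0 hQ
  rw [← h, hP.totalDegree hP0, hL.totalDegree hL0] at h1
  exact ⟨_, totalDegree_eq_zero_iff_eq_C.mp (by omega)⟩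

lemma aux_prime {K : Type*} [Field K] {n : ℕ} {L : MvPolynomial (Fin (n + 1)) K}
    (hL : L.IsHomogeneous 1) (hL0 : L ≠ 0) : Prime L := by
  have hd := hL.totalDegree hL0
  have key : ∀ A : MvPolynomial (Fin (n + 1)) K, A ≠ 0 → A.totalDegree = 0 → IsUnit A := by
    intro A hA h
    have h2 := totalDegree_eq_zero_iff_eq_C.mp h
    rw [h2] at hA ⊢
    refine IsUnit.map C (IsUnit.mk0 _ ?_)
    intro h0
    exact hA (by rw [h0, C_0])
  rw [← irreducible_iff_prime]
  refine ⟨fun hu => ?_, fun A B hAB => ?_⟩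
  · obtain ⟨B, hB⟩ := hu.exists_right_inv
    have hB0 : B ≠ 0 := by rintro rfl; simp at hB
    have := totalDegree_mul_of_isDomain hL0 hB0
    rw [hB, totalDegree_one] at this
    omega
  · have hA : A ≠ 0 := by rintro rfl; simp at hAB; exact hL0 hAB
    have hB : B ≠ 0 := by rintro rfl; simp at hAB; exact hL0 hAB
    have := totalDegree_mul_of_isDomain hA hB
    rw [← hAB, hd] at this
    by_cases h : A.totalDegree = 0
    · exact Or.inl (key A hA h)
    · exact Or.inr (key B hB (by omega))

/-- Lemma 2.3(a): if `q₁,…,q_a` are linearly independent quadrics and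
`V₁, V₂` are linearly independent linear syzygies on them, then no nontrivial relation
`L₁·V₁ + L₂·V₂ = 0` with `L₁, L₂` linear forms exists; i.e. `v = (2,1)` cannot occur. -/
theorem stmt1 (K : Type*) [Field K] (n a : ℕ)
    (q : Fin a → MvPolynomial (Fin (n + 1)) K)
    (hq : ∀ i, (q i).IsHomogeneous 2) (hqind : LinearIndependent K q)
    (V₁ V₂ : Fin a → MvPolynomial (Fin (n + 1)) K)
    (hV₁ : ∀ i, (V₁ i).IsHomogeneous 1) (hV₂ : ∀ i, (V₂ i).IsHomogeneous 1)
    (hVind : LinearIndependent K ![V₁, V₂])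
    (hsyz₁ : ∑ i, V₁ i * q i = 0) (hsyz₂ : ∑ i, V₂ i * q i = 0)
    (L₁ L₂ : MvPolynomial (Fin (n + 1)) K)
    (hL₁ : L₁.IsHomogeneous 1) (hL₂ : L₂.IsHomogeneous 1)
    (hrel : ∀ i, L₁ * V₁ i + L₂ * V₂ i = 0) :
    L₁ = 0 ∧ L₂ = 0 := by
  have hpair := LinearIndependent.pair_iff.mp hVind
  have hV1 : V₁ ≠ 0 := by
    rintro rfl
    simpa using hpair 1 0 (by simp)
  have hV2 : V₂ ≠ 0 := by
    rintro rfl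
    simpa using hpair 0 1 (by simp)
  obtain ⟨i₁, hi₁⟩ := Function.ne_iff.mp hV1
  obtain ⟨i₂, hi₂⟩ := Function.ne_iff.mp hV2
  by_cases h1 : L₁ = 0
  · refine ⟨h1, ?_⟩
    have := hrel i₂
    rw [h1, zero_mul, zero_add] at this
    exact (mul_eq_zero.mp this).resolve_right hi₂
  exfalso
  have hp := aux_prime hL₁ h1
  by_cases hdvd : L₁ ∣ L₂
  · obtain ⟨Q, hQ⟩ := hdvd
    obtain ⟨c, rfl⟩ := aux_const hL₁ hL₂ h1 hQ
    have := hpair 1 c (by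
      funext i
      have h := hrel i
      rw [hQ, mul_assoc, ← mul_add] at h
      have h' := (mul_eq_zero.mp h).resolve_left h1
      simpa [smul_eq_C_mul] using h')
    exact one_ne_zero this.1
  · have hc : ∀ i, ∃ c : K, V₂ i = L₁ * C c := by
      intro i
      have h : L₁ ∣ L₂ * V₂ i := ⟨- V₁ i, by linear_combination hrel i⟩
      obtain ⟨Q, hQ⟩ := (hp.dvd_or_dvd h).resolve_left hdvd
      obtain ⟨c, rfl⟩ := aux_const hL₁ (hV₂ i) h1 hQ
      exact ⟨c, hQ⟩
    choose c hc using hc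
    have hs : L₁ * ∑ i, c i • q i = 0 := by
      rw [← hsyz₂, Finset.mul_sum]
      refine Finset.sum_congr rfl fun i _ => ?_
      rw [hc i, smul_eq_C_mul, mul_assoc]
    have h0 := Fintype.linearIndependent_iff.mp hqind c
      ((mul_eq_zero.mp hs).resolve_left h1) i₂
    apply hi₂
    rw [hc i₂, h0]
    simp
end

section
/- Let K be a field, S = K[x_1,…,x_n] with n ≥ 3, and let q_1,…,q_a ∈ S be K-linearly independent quadrics. Suppose V_1, V_2, V_3 ∈ (S_1)^a are linear syzygies on (q_1,…,q_a) (i.e. Σ_{i=1}^a V_k(i)·q_i = 0 for k = 1,2,3), not all three zero, and suppose x_1·V_1 + x_2·V_2 + x_3·V_3 = 0 componentwise. Then there exists a nonzero linear form L ∈ S_1 such that L·x_1, L·x_2 and L·x_3 all lie in the K-linear span of q_1,…,q_a. -/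
open MvPolynomial


lemma aux_coeff {K : Type*} [Field K] {n : ℕ} (V : MvPolynomial (Fin n) K) (j k l : Fin n) :
    coeff (Finsupp.single j 1 + Finsupp.single k 1) (X l * V) =
      if l = j then coeff (Finsupp.single k 1) V
      else if l = k then coeff (Finsupp.single j 1) V else 0 := by
  classical
  by_cases h1 : l = j
  · subst h1
    simp [coeff_X_mul]
  · by_cases h2 : l = k
    · subst h2
      rw [add_comm, coeff_X_mul]
      simp [h1]
    · rw [coeff_X_mul', if_neg]
      · simp [h1, h2]
      · simp [Ne.symm h1, Ne.symm h2, eq_comm]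

lemma aux_ext {K : Type*} [Field K] {n : ℕ} {V W : MvPolynomial (Fin n) K}
    (hV : V.IsHomogeneous 1) (hW : W.IsHomogeneous 1)
    (h : ∀ j, coeff (Finsupp.single j 1) V = coeff (Finsupp.single j 1) W) : V = W := by
  ext m
  by_cases hm : m.degree = 1
  · obtain ⟨j, rfl⟩ := (Finsupp.sum_eq_one_iff m).1 hm
    exact h j
  · rw [hV.coeff_eq_zero hm, hW.coeff_eq_zero hm]

lemma aux_koszul {K : Type*} [Field K] {n : ℕ} {x y z : Fin n} (hxy : x ≠ y) (hxz : x ≠ z)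
    (hyz : y ≠ z) {U V W : MvPolynomial (Fin n) K}
    (hU : U.IsHomogeneous 1) (hV : V.IsHomogeneous 1) (hW : W.IsHomogeneous 1)
    (h : X x * U + X y * V + X z * W = 0) :
    ∃ a b c : K, U = C a * X y + C b * X z ∧ V = - (C a * X x) + C c * X z ∧
      W = - (C b * X x) - C c * X y := by
  classical
  have key : ∀ j k : Fin n, _ := fun j k =>
    congrArg (coeff (Finsupp.single j 1 + Finsupp.single k 1)) h
  simp only [coeff_add, aux_coeff, coeff_zero] at key
  have hC : ∀ (a : K) (i : Fin n), (C a * X i : MvPolynomial (Fin n) K).IsHomogeneous 1 :=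
    fun a i => by simpa using (isHomogeneous_C (Fin n) a).mul (isHomogeneous_X K i)
  have hcf : ∀ (a : K) (i j : Fin n), coeff (Finsupp.single j 1)
      (C a * X i : MvPolynomial (Fin n) K) = if i = j then a else 0 := by
    intro a i j
    rw [coeff_C_mul, coeff_X]
    simp [Finsupp.single_left_inj]
  refine ⟨coeff (Finsupp.single y 1) U, coeff (Finsupp.single z 1) U,
    coeff (Finsupp.single z 1) V, ?_, ?_, ?_⟩
  · refine aux_ext hU ((hC _ _).add (hC _ _)) fun j => ?_
    rw [coeff_add, hcf, hcf]
    have := key x j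
    have := key x x
    grind
  · refine aux_ext hV ((hC _ _).neg.add (hC _ _)) fun j => ?_
    rw [coeff_add, coeff_neg, hcf, hcf]
    have := key y j
    have := key y y
    have := key x y
    grind
  · refine aux_ext hW ((hC _ _).neg.sub (hC _ _)) fun j => ?_
    rw [coeff_sub, coeff_neg, hcf, hcf]
    have := key z j
    have := key z z
    have := key x z
    have := key y z
    grind

/-- key claim of Lemma 2.3(b): a rank-3 linear second syzygy
`x₁·V₁ + x₂·V₂ + x₃·V₃ = 0` among linear syzygies `V₁, V₂, V₃` (not all zero) on
linearly independent quadrics `q₁,…,q_a` forces the span of the quadrics to contain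
`L·x₁, L·x₂, L·x₃` for some nonzero linear form `L`. -/
theorem stmt3 (K : Type*) [Field K] (n a : ℕ) (hn : 3 ≤ n)
    (q : Fin a → MvPolynomial (Fin n) K)
    (hq : ∀ i, (q i).IsHomogeneous 2) (hqind : LinearIndependent K q)
    (V₁ V₂ V₃ : Fin a → MvPolynomial (Fin n) K)
    (hV₁ : ∀ i, (V₁ i).IsHomogeneous 1) (hV₂ : ∀ i, (V₂ i).IsHomogeneous 1)
    (hV₃ : ∀ i, (V₃ i).IsHomogeneous 1)
    (hsyz₁ : ∑ i, V₁ i * q i = 0) (hsyz₂ : ∑ i, V₂ i * q i = 0)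
    (hsyz₃ : ∑ i, V₃ i * q i = 0)
    (hne : ¬(V₁ = 0 ∧ V₂ = 0 ∧ V₃ = 0))
    (hrel : ∀ i,
      X (⟨0, by omega⟩ : Fin n) * V₁ i + X (⟨1, by omega⟩ : Fin n) * V₂ i +
        X (⟨2, by omega⟩ : Fin n) * V₃ i = 0) :
    ∃ L : MvPolynomial (Fin n) K, L ≠ 0 ∧ L.IsHomogeneous 1 ∧
      L * X (⟨0, by omega⟩ : Fin n) ∈ Submodule.span K (Set.range q) ∧
      L * X (⟨1, by omega⟩ : Fin n) ∈ Submodule.span K (Set.range q) ∧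
      L * X (⟨2, by omega⟩ : Fin n) ∈ Submodule.span K (Set.range q) := by
  have hxy : (⟨0, by omega⟩ : Fin n) ≠ ⟨1, by omega⟩ := by simp
  have hxz : (⟨0, by omega⟩ : Fin n) ≠ ⟨2, by omega⟩ := by simp
  have hyz : (⟨1, by omega⟩ : Fin n) ≠ ⟨2, by omega⟩ := by simp
  generalize (⟨0, by omega⟩ : Fin n) = x at *
  generalize (⟨1, by omega⟩ : Fin n) = y at *
  generalize (⟨2, by omega⟩ : Fin n) = z at *
  choose α β γ h1 h2 h3 using fun i =>
    aux_koszul hxy hxz hyz (hV₁ i) (hV₂ i) (hV₃ i) (hrel i)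
  have hmem : ∀ f : Fin a → K, ∑ i, C (f i) * q i ∈ Submodule.span K (Set.range q) := by
    intro f
    refine Submodule.sum_mem _ fun i _ => ?_
    rw [← smul_eq_C_mul]
    exact Submodule.smul_mem _ _ (Submodule.subset_span ⟨i, rfl⟩)
  have hzero : ∀ f : Fin a → K, ∑ i, C (f i) * q i = 0 → ∀ i, f i = 0 := by
    intro f hf
    refine Fintype.linearIndependent_iff.1 hqind f ?_
    simpa only [smul_eq_C_mul] using hf
  have hAh : (∑ i, C (α i) * q i).IsHomogeneous 2 := by
    refine IsHomogeneous.sum _ _ _ fun i _ => ?_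
    simpa using (isHomogeneous_C (Fin n) (α i)).mul (hq i)
  have e1 : X y * (∑ i, C (α i) * q i) + X z * (∑ i, C (β i) * q i) = 0 := by
    rw [← hsyz₁, Finset.mul_sum, Finset.mul_sum, ← Finset.sum_add_distrib]
    refine Finset.sum_congr rfl fun i _ => ?_
    rw [h1 i]; ring
  have e2 : - (X x * (∑ i, C (α i) * q i)) + X z * (∑ i, C (γ i) * q i) = 0 := by
    rw [← hsyz₂, Finset.mul_sum, Finset.mul_sum, ← Finset.sum_neg_distrib,
      ← Finset.sum_add_distrib]
    refine Finset.sum_congr rfl fun i _ => ?_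
    rw [h2 i]; ring
  have mA := hmem α
  have mB := hmem β
  have mC := hmem γ
  have zA := hzero α
  have zB := hzero β
  have zC := hzero γ
  generalize (∑ i, C (α i) * q i) = A at *
  generalize (∑ i, C (β i) * q i) = B at *
  generalize (∑ i, C (γ i) * q i) = D at *
  have hz0 : (X z : MvPolynomial (Fin n) K) ≠ 0 := X_ne_zero z
  have hdvd : (X z : MvPolynomial (Fin n) K) ∣ A := by
    have h : (X z : MvPolynomial (Fin n) K) ∣ X y * A := ⟨-B, by linear_combination e1⟩
    refine ((X_prime (i := z)).dvd_or_dvd h).resolve_left fun h' => ?_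
    rw [X_dvd_X] at h'
    grind
  obtain ⟨L, rfl⟩ := hdvd
  have hB : B = - (L * X y) := by
    apply mul_left_cancel₀ hz0
    linear_combination e1
  have hD : D = L * X x := by
    apply mul_left_cancel₀ hz0
    linear_combination e2
  refine ⟨L, ?_, ?_, ?_, ?_, ?_⟩
  · rintro rfl
    apply hne
    have a0 := zA (by simp)
    have b0 := zB (by simp [hB])
    have c0 := zC (by simp [hD])
    refine ⟨funext fun i => ?_, funext fun i => ?_, funext fun i => ?_⟩
    · simp [h1, a0, b0]
    · simp [h2, a0, c0]
    · simp [h3, b0, c0]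
  · intro d hd
    have := @hAh (Finsupp.single z 1 + d) (by rwa [coeff_X_mul])
    rw [map_add] at this
    simp [Finsupp.weight_single] at this ⊢
    omega
  · rwa [← hD]
  · have := Submodule.neg_mem _ mB
    rwa [hB, neg_neg] at this
  · rwa [mul_comm]
end

section
/- Let K be a field, S = K[x_1,…,x_8], let q_1, q_2, q_3 ∈ S be homogeneous polynomials of degree 2, and let g_1 = x_1x_5 − x_2x_4, g_2 = x_1x_6 − x_3x_4, g_3 = x_2x_6 − x_3x_5, g_4 = x_3q_1 − x_2q_2 + x_1q_3, g_5 = x_6q_1 − x_5q_2 + x_4q_3. For any point p ∈ K^8 with p_1 = p_2 = p_3 = p_4 = p_5 = p_6 = 0, the 5×8 Jacobian matrix whose (i,j) entry is the partial derivative ∂g_i/∂x_j evaluated at p has rank at most 2. -/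
open MvPolynomial

/-- The five sub-Pfaffians `g₁,…,g₅` of the matrix `N` of Proposition 3.5, as
polynomials in `S = K[x_1,…,x_8]` (variables `x_i ↦ X (i-1)`). -/
noncomputable def gvec {K : Type*} [Field K] (q₁ q₂ q₃ : MvPolynomial (Fin 8) K) :
    Fin 5 → MvPolynomial (Fin 8) K :=
  ![X 0 * X 4 - X 1 * X 3,
    X 0 * X 5 - X 2 * X 3,
    X 1 * X 5 - X 2 * X 4,
    X 2 * q₁ - X 1 * q₂ + X 0 * q₃,
    X 5 * q₁ - X 4 * q₂ + X 3 * q₃]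

/-- Jacobian computation of Proposition 3.5: at every point `p` with
`p₁ = ⋯ = p₆ = 0`, the 5×8 Jacobian matrix `(∂gᵢ/∂xⱼ)(p)` has rank at most 2. -/
theorem stmt7 (K : Type*) [Field K] (q₁ q₂ q₃ : MvPolynomial (Fin 8) K)
    (hq₁ : q₁.IsHomogeneous 2) (hq₂ : q₂.IsHomogeneous 2) (hq₃ : q₃.IsHomogeneous 2)
    (p : Fin 8 → K)
    (hp : p 0 = 0 ∧ p 1 = 0 ∧ p 2 = 0 ∧ p 3 = 0 ∧ p 4 = 0 ∧ p 5 = 0) :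
    Matrix.rank
      (Matrix.of fun (i : Fin 5) (j : Fin 8) =>
        MvPolynomial.eval p (MvPolynomial.pderiv j (gvec q₁ q₂ q₃ i))) ≤ 2 := by
  obtain ⟨h0, h1, h2, h3, h4, h5⟩ := hp
  set M : Matrix (Fin 5) (Fin 8) K := Matrix.of fun (i : Fin 5) (j : Fin 8) =>
        MvPolynomial.eval p (MvPolynomial.pderiv j (gvec q₁ q₂ q₃ i)) with hM
  -- the first three rows vanish at `p`, so `M` factors through `K ^ 2`
  have key : M = (!![0, 0; 0, 0; 0, 0; 1, 0; 0, 1] : Matrix (Fin 5) (Fin 2) K) *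
      (Matrix.of ![M 3, M 4] : Matrix (Fin 2) (Fin 8) K) := by
    have r0 : ∀ j, M 0 j = 0 := fun j => by
      simp [hM, gvec, Derivation.leibniz, h0, h1, h3, h4]
    have r1 : ∀ j, M 1 j = 0 := fun j => by
      simp [hM, gvec, Derivation.leibniz, h0, h2, h3, h5]
    have r2 : ∀ j, M 2 j = 0 := fun j => by
      simp [hM, gvec, Derivation.leibniz, h1, h2, h4, h5]
    clear_value M
    ext i j
    fin_cases i <;> simp [Matrix.mul_apply, Fin.sum_univ_two, r0, r1, r2]
  rw [key]
  exact (Matrix.rank_mul_le_left _ _).trans (Matrix.rank_le_width _)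
end

section
/- Let K be a field of characteristic zero, S = K[x_1,x_2,x_3,x_4], and let q_1, q_2, q_3 ∈ S be K-linearly independent quadrics. Then the K-vector space of linear syzygies {(l_1,l_2,l_3) ∈ (S_1)^3 : l_1q_1 + l_2q_2 + l_3q_3 = 0} has dimension at most 3. -/
open MvPolynomial

/-- A subspace of large dimension contains a nonzero polynomial whose leading monomial avoids
a given small finite set. -/
lemma exists_degree_notMem {K : Type*} [Field K] (o : MonomialOrder (Fin 4))
    (q : Fin 3 → MvPolynomial (Fin 4) K) (hq : LinearIndependent K q)
    (T : Finset (Fin 4 →₀ ℕ)) (hT : T.card < 3) :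
    ∃ f ∈ Submodule.span K (Set.range q), f ≠ 0 ∧ o.degree f ∉ T := by
  let ev : (Fin 3 → K) →ₗ[K] (T → K) :=
    (LinearMap.pi fun t : T => lcoeff K t.1) ∘ₗ (Fintype.linearCombination K q)
  have hlt : Module.finrank K (T → K) < Module.finrank K (Fin 3 → K) := by simpa using hT
  have hker := LinearMap.ker_ne_bot_of_finrank_lt (f := ev) hlt
  obtain ⟨c, hc, hc0⟩ := Submodule.exists_mem_ne_zero_of_ne_bot hker
  have hf0 : Fintype.linearCombination K q c ≠ 0 := by
    intro h
    apply hc0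
    have := Fintype.linearIndependent_iff.1 hq c (by simpa [Fintype.linearCombination_apply] using h)
    funext i
    exact this i
  refine ⟨Fintype.linearCombination K q c, ?_, hf0, ?_⟩
  · rw [← Fintype.range_linearCombination]
    exact ⟨c, rfl⟩
  · intro hmem
    have h1 := congrFun (LinearMap.mem_ker.1 hc) ⟨_, hmem⟩
    exact (o.coeff_degree_ne_zero_iff.2 hf0) h1

/-- A finite set of leading monomials of elements of a finite-dimensional subspace has at most
as many elements as the dimension. -/
lemma card_degrees_le {K : Type*} [Field K] (o : MonomialOrder (Fin 4))
    (R : Submodule K (MvPolynomial (Fin 4) K)) [FiniteDimensional K R]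
    (E : Finset (Fin 4 →₀ ℕ)) (hE : ∀ e ∈ E, ∃ f ∈ R, f ≠ 0 ∧ o.degree f = e) :
    E.card ≤ Module.finrank K R := by
  classical
  choose! f hfR hf0 hfd using hE
  have hli : LinearIndependent K (fun e : E => (⟨f e.1, hfR e.1 e.2⟩ : R)) := by
    apply LinearIndependent.of_comp R.subtype
    rw [Fintype.linearIndependent_iff]
    intro g hg
    by_contra! hne
    obtain ⟨i, hi⟩ := hne
    obtain ⟨e, he, hmax⟩ := Finset.exists_max_image
      (Finset.univ.filter fun e : E => g e ≠ 0) (fun e => o.toSyn e.1) ⟨i, by simpa using hi⟩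
    have hge : g e ≠ 0 := by simpa using he
    have h1 := congrArg (coeff e.1) hg
    rw [coeff_sum, Finset.sum_eq_single e] at h1
    · have h2 : coeff e.1 (f e.1) ≠ 0 := by
        have := o.coeff_degree_ne_zero_iff.2 (hf0 e.1 e.2)
        rwa [hfd e.1 e.2] at this
      simp [hge, h2] at h1
    · intro b _ hb
      by_cases hgb : g b = 0
      · simp [hgb]
      · have h3 := hmax b (by simpa using hgb)
        have h4 : o.toSyn b.1 < o.toSyn e.1 := by
          refine lt_of_le_of_ne h3 fun h => hb ?_
          exact Subtype.ext (o.toSyn.injective h)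
        have h5 : coeff e.1 (f b.1) = 0 := by
          apply o.coeff_eq_zero_of_lt
          rw [hfd b.1 b.2]
          exact h4
        simp [h5]
    · simp
  simpa using hli.fintype_card_le_finrank

/-- The monomials obtained by multiplying `d` by a variable. -/
noncomputable def shiftSet (d : Fin 4 →₀ ℕ) : Finset (Fin 4 →₀ ℕ) :=
  Finset.univ.image fun i => Finsupp.single i 1 + d

lemma shiftSet_card (d : Fin 4 →₀ ℕ) : (shiftSet d).card = 4 := by
  unfold shiftSet
  rw [Finset.card_image_of_injective]
  · simp
  · intro i j h
    have := add_right_cancel h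
    exact Finsupp.single_left_injective one_ne_zero this

lemma shiftSet_inter (d e : Fin 4 →₀ ℕ) (h : d ≠ e) : (shiftSet d ∩ shiftSet e).card ≤ 1 := by
  rw [Finset.card_le_one]
  intro a ha b hb
  simp only [shiftSet, Finset.mem_inter, Finset.mem_image, Finset.mem_univ, true_and] at ha hb
  obtain ⟨⟨i, rfl⟩, i', hi⟩ := ha
  obtain ⟨⟨j, rfl⟩, j', hj⟩ := hb
  by_cases hij : i = j
  · rw [hij]
  exfalso
  have hii : i' ≠ i := by
    rintro rfl
    exact h (add_left_cancel hi).symm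
  have h1 := DFunLike.congr_fun hi i
  have h2 := DFunLike.congr_fun hj i
  simp only [Finsupp.add_apply, Finsupp.single_apply, if_neg hii, if_neg (Ne.symm hij)] at h1 h2
  simp at h1
  omega

lemma shiftSet_union (a b c : Fin 4 →₀ ℕ) (hab : a ≠ b) (hac : a ≠ c) (hbc : b ≠ c) :
    9 ≤ (shiftSet a ∪ shiftSet b ∪ shiftSet c).card := by
  have h1 := Finset.card_union_add_card_inter (shiftSet a) (shiftSet b)
  have h2 := Finset.card_union_add_card_inter (shiftSet a ∪ shiftSet b) (shiftSet c)
  rw [Finset.union_inter_distrib_right] at h2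
  have h3 := Finset.card_union_le (shiftSet a ∩ shiftSet c) (shiftSet b ∩ shiftSet c)
  have := shiftSet_inter a b hab
  have := shiftSet_inter a c hac
  have := shiftSet_inter b c hbc
  simp only [shiftSet_card] at *
  omega

/-- for 3 linearly independent quadrics in `S = K[x₁,…,x₄]`
(`char K = 0`), the space of linear syzygies has dimension at most 3: every
linearly independent family of linear syzygies has at most 3 members. -/
theorem stmt8 (K : Type*) [Field K] [CharZero K]
    (q : Fin 3 → MvPolynomial (Fin 4) K)
    (hq : ∀ i, (q i).IsHomogeneous 2) (hqind : LinearIndependent K q)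
    (m : ℕ) (V : Fin m → (Fin 3 → MvPolynomial (Fin 4) K))
    (hVhom : ∀ k i, (V k i).IsHomogeneous 1)
    (hVsyz : ∀ k, ∑ i, V k i * q i = 0)
    (hVind : LinearIndependent K V) :
    m ≤ 3 := by
  let L : (Fin 3 × Fin 4 → K) →ₗ[K] (Fin 3 → MvPolynomial (Fin 4) K) :=
    LinearMap.pi fun i => ∑ j, (LinearMap.proj (i, j)).smulRight (X j)
  have hL : ∀ c i, L c i = ∑ j, c (i, j) • (X j : MvPolynomial (Fin 4) K) := by
    intro c i
    simp [L]
  let P : (Fin 3 → MvPolynomial (Fin 4) K) →ₗ[K] MvPolynomial (Fin 4) K :=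
    ∑ i, (LinearMap.mulRight K (q i)) ∘ₗ LinearMap.proj i
  have hP : ∀ v, P v = ∑ i, v i * q i := by
    intro v
    simp [P]
  let φ := P ∘ₗ L
  have hex : ∀ k i, ∃ c : Fin 4 → K, ∑ j, c j • (X j : MvPolynomial (Fin 4) K) = V k i := by
    intro k i
    have h : V k i ∈ homogeneousSubmodule (Fin 4) K 1 := hVhom k i
    rw [homogeneousSubmodule_one_eq_span_X] at h
    exact (Submodule.mem_span_range_iff_exists_fun K).1 h
  choose c hc using hex
  have hLc : ∀ k, L (fun p => c k p.1 p.2) = V k := by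
    intro k
    funext i
    rw [hL, ← hc]
  have hm : m ≤ Module.finrank K (LinearMap.ker φ) := by
    have hli : LinearIndependent K (fun k : Fin m =>
        (⟨fun p => c k p.1 p.2, by
          rw [LinearMap.mem_ker, LinearMap.comp_apply, hLc, hP, hVsyz]⟩ : LinearMap.ker φ)) := by
      apply LinearIndependent.of_comp (L ∘ₗ (LinearMap.ker φ).subtype)
      convert hVind using 1
      funext k
      exact hLc k
    simpa using hli.fintype_card_le_finrank
  have hrn := φ.finrank_range_add_finrank_ker
  have h12 : Module.finrank K (Fin 3 × Fin 4 → K) = 12 := by simp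
  have hmul : ∀ f ∈ Submodule.span K (Set.range q), ∀ j, X j * f ∈ LinearMap.range φ := by
    intro f hf j
    obtain ⟨a, rfl⟩ := (Submodule.mem_span_range_iff_exists_fun K).1 hf
    refine ⟨fun p => if p.2 = j then a p.1 else 0, ?_⟩
    rw [LinearMap.comp_apply, hP, Finset.mul_sum]
    refine Finset.sum_congr rfl fun i _ => ?_
    rw [hL]
    simp
  let o : MonomialOrder (Fin 4) := MonomialOrder.lex
  obtain ⟨f₁, hf₁, h₁, -⟩ := exists_degree_notMem o q hqind ∅ (by simp)
  obtain ⟨f₂, hf₂, h₂, hd₂⟩ := exists_degree_notMem o q hqind {o.degree f₁} (by simp)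
  obtain ⟨f₃, hf₃, h₃, hd₃⟩ := exists_degree_notMem o q hqind {o.degree f₁, o.degree f₂}
    (lt_of_le_of_lt Finset.card_le_two (by norm_num))
  simp only [Finset.mem_singleton, Finset.mem_insert, not_or] at hd₂ hd₃
  have h9 := shiftSet_union _ _ _ (Ne.symm hd₂) (Ne.symm hd₃.1) (Ne.symm hd₃.2)
  have key : ∀ f ∈ Submodule.span K (Set.range q), f ≠ 0 → ∀ e ∈ shiftSet (o.degree f),
      ∃ g ∈ LinearMap.range φ, g ≠ 0 ∧ o.degree g = e := by
    intro f hf hf0 e he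
    simp only [shiftSet, Finset.mem_image, Finset.mem_univ, true_and] at he
    obtain ⟨j, rfl⟩ := he
    refine ⟨X j * f, hmul f hf j, mul_ne_zero (X_ne_zero j) hf0, ?_⟩
    rw [o.degree_mul (X_ne_zero j) hf0, o.degree_X]
  have hr := card_degrees_le o (LinearMap.range φ) _ (fun e he => by
    rcases Finset.mem_union.1 he with he | he
    · rcases Finset.mem_union.1 he with he | he
      · exact key f₁ hf₁ h₁ e he
      · exact key f₂ hf₂ h₂ e he
    · exact key f₃ hf₃ h₃ e he)
  omega
end

section
/- Let K be a field of characteristic zero, S = K[x_1,x_2,x_3,x_4], and let q_1, q_2, q_3, q_4 ∈ S be K-linearly independent quadrics. Then the K-vector space of linear syzygies {(l_1,l_2,l_3,l_4) ∈ (S_1)^4 : Σ_{i=1}^4 l_iq_i = 0} has dimension at most 6. -/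
open MvPolynomial

theorem aux_comb : ∀ T ∈ Finset.powersetCard 4
    ({2,5,17,65,8,20,68,32,80,128} : Finset ℕ),
    10 ≤ (T.biUnion fun c => {c+1,c+4,c+16,c+64}).card := by decide +kernel

/-- The dimension of a space of polynomials is at most the number of its leading exponents. -/
theorem aux_le {K : Type*} [Field K] (o : MonomialOrder (Fin 4))
    (W : Submodule K (MvPolynomial (Fin 4) K)) (D : Finset (Fin 4 →₀ ℕ))
    (hD : ∀ w ∈ W, w ≠ 0 → o.degree w ∈ D) : Module.finrank K W ≤ D.card := by
  let φ : W →ₗ[K] (D → K) :=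
    LinearMap.pi fun d => (MvPolynomial.lcoeff K d.1) ∘ₗ W.subtype
  have hφ : Function.Injective φ := by
    rw [← LinearMap.ker_eq_bot, LinearMap.ker_eq_bot']
    intro w hw
    by_contra hne
    have hne' : (w : MvPolynomial (Fin 4) K) ≠ 0 := fun h => hne (Subtype.ext h)
    have h1 := congrFun hw ⟨o.degree w.1, hD w w.2 hne'⟩
    exact (o.coeff_degree_ne_zero_iff.mpr hne') h1
  have := LinearMap.finrank_le_finrank_of_injective hφ
  simpa using this

/-- The dimension of a space of polynomials is at least the number of its leading exponents. -/
theorem aux_ge {K : Type*} [Field K] (o : MonomialOrder (Fin 4))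
    (W : Submodule K (MvPolynomial (Fin 4) K)) [FiniteDimensional K W]
    (D : Finset (Fin 4 →₀ ℕ))
    (hD : ∀ d ∈ D, ∃ w ∈ W, w ≠ 0 ∧ o.degree w = d) : D.card ≤ Module.finrank K W := by
  classical
  choose! p hpW hp0 hpd using hD
  have hind : LinearIndependent K (fun d : D => (⟨p d, hpW d d.2⟩ : W)) := by
    rw [Fintype.linearIndependent_iff]
    intro g hg
    by_contra! hne
    have hne' : (Finset.univ.filter fun d : D => g d ≠ 0).Nonempty := by
      obtain ⟨i, hi⟩ := hne
      exact ⟨i, by simp [hi]⟩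
    obtain ⟨d, hd, hmax⟩ := Finset.exists_max_image _ (fun d : D => o.toSyn d.1) hne'
    have hgd : g d ≠ 0 := by simpa using hd
    have h1 : ∑ i : D, g i • p i = 0 := by
      have := congrArg Subtype.val hg
      simpa using this
    have h2 := congrArg (MvPolynomial.coeff d.1) h1
    rw [MvPolynomial.coeff_sum, Finset.sum_eq_single d] at h2
    · rw [MvPolynomial.coeff_smul, smul_eq_mul, MvPolynomial.coeff_zero] at h2
      rcases mul_eq_zero.mp h2 with h | h
      · exact hgd h
      · have := o.coeff_degree_ne_zero_iff.mpr (hp0 d d.2)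
        rw [hpd d d.2] at this
        exact this h
    · intro b _ hbd
      rw [MvPolynomial.coeff_smul, smul_eq_mul]
      by_cases hb : g b = 0
      · simp [hb]
      · have hle := hmax b (by simpa using hb)
        have hlt : o.toSyn b.1 < o.toSyn d.1 := by
          refine lt_of_le_of_ne hle ?_
          intro h
          exact hbd (Subtype.ext (o.toSyn.injective h))
        rw [o.coeff_eq_zero_of_lt (by rw [hpd b b.2]; exact hlt), mul_zero]
    · simp
  simpa using hind.fintype_card_le_finrank

/-- Encoding of exponents by natural numbers. -/
def aux_code (d : Fin 4 →₀ ℕ) : ℕ := d 0 + 4 * d 1 + 16 * d 2 + 64 * d 3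

theorem aux_growth (T : Finset (Fin 4 →₀ ℕ)) (hT : T.card = 4)
    (hdeg : ∀ d ∈ T, d 0 + d 1 + d 2 + d 3 = 2) :
    10 ≤ (T.biUnion fun d => Finset.univ.image fun i : Fin 4 => d + Finsupp.single i 1).card := by
  have hinj : Set.InjOn aux_code T := by
    intro a ha b hb hab
    have h1 := hdeg a ha
    have h2 := hdeg b hb
    simp only [aux_code] at hab
    have e3 : a 3 = b 3 := by omega
    have e2 : a 2 = b 2 := by omega
    have e1 : a 1 = b 1 := by omega
    have e0 : a 0 = b 0 := by omega
    ext i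
    fin_cases i
    exacts [e0, e1, e2, e3]
  have hmem : T.image aux_code ∈ Finset.powersetCard 4
      ({2,5,17,65,8,20,68,32,80,128} : Finset ℕ) := by
    rw [Finset.mem_powersetCard]
    refine ⟨?_, by rw [Finset.card_image_of_injOn hinj, hT]⟩
    intro c hc
    obtain ⟨d, hd, rfl⟩ := Finset.mem_image.mp hc
    have h1 := hdeg d hd
    simp only [aux_code, Finset.mem_insert, Finset.mem_singleton]
    omega
  refine (aux_comb _ hmem).trans ?_
  refine le_trans (Finset.card_le_card ?_) (Finset.card_image_le (f := aux_code))
  intro c hc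
  simp only [Finset.mem_biUnion, Finset.mem_image, Finset.mem_insert, Finset.mem_singleton] at hc
  obtain ⟨_, ⟨d, hd, rfl⟩, hc⟩ := hc
  simp only [Finset.mem_biUnion, Finset.mem_image, Finset.mem_univ, true_and]
  rcases hc with h | h | h | h
  · exact ⟨_, ⟨d, hd, 0, rfl⟩, by simp [aux_code, h]; omega⟩
  · exact ⟨_, ⟨d, hd, 1, rfl⟩, by simp [aux_code, h]; omega⟩
  · exact ⟨_, ⟨d, hd, 2, rfl⟩, by simp [aux_code, h]; omega⟩
  · exact ⟨_, ⟨d, hd, 3, rfl⟩, by simp [aux_code, h]; omega⟩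

theorem aux_linear {K : Type*} [Field K] (l : MvPolynomial (Fin 4) K) (hl : l.IsHomogeneous 1) :
    l = ∑ j, MvPolynomial.coeff (Finsupp.single j 1) l • X j := by
  ext d
  rw [MvPolynomial.coeff_sum]
  simp only [MvPolynomial.coeff_smul, MvPolynomial.coeff_X, smul_eq_mul, mul_ite, mul_one,
    mul_zero]
  by_cases h : ∃ j, Finsupp.single j 1 = d
  · obtain ⟨j, rfl⟩ := h
    rw [Finset.sum_eq_single j]
    · simp
    · intro b _ hb
      rw [if_neg]
      intro h
      exact hb (Finsupp.single_left_injective one_ne_zero h)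
    · simp
  · push Not at h
    rw [Finset.sum_eq_zero (fun j _ => if_neg (h j))]
    by_contra hne
    have h1 := hl hne
    have h1 : Finsupp.degree d = 1 := by
      rw [Finsupp.degree_eq_weight_one]; exact h1
    rw [Finsupp.degree_eq_sum, Fin.sum_univ_four] at h1
    have key : d 0 = 1 ∨ d 1 = 1 ∨ d 2 = 1 ∨ d 3 = 1 := by omega
    rcases key with h2 | h2 | h2 | h2
    · apply h 0; ext i; fin_cases i <;> simp <;> omega
    · apply h 1; ext i; fin_cases i <;> simp <;> omega
    · apply h 2; ext i; fin_cases i <;> simp <;> omega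
    · apply h 3; ext i; fin_cases i <;> simp <;> omega

/-- for 4 linearly independent quadrics in `S = K[x₁,…,x₄]`
(`char K = 0`), the space of linear syzygies has dimension at most 6: every
linearly independent family of linear syzygies has at most 6 members. -/
theorem stmt9 (K : Type*) [Field K] [CharZero K]
    (q : Fin 4 → MvPolynomial (Fin 4) K)
    (hq : ∀ i, (q i).IsHomogeneous 2) (hqind : LinearIndependent K q)
    (m : ℕ) (V : Fin m → (Fin 4 → MvPolynomial (Fin 4) K))
    (hVhom : ∀ k i, (V k i).IsHomogeneous 1)
    (hVsyz : ∀ k, ∑ i, V k i * q i = 0)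
    (hVind : LinearIndependent K V) :
    m ≤ 6 := by
  classical
  let o : MonomialOrder (Fin 4) := MonomialOrder.lex
  let ψ : (Fin 4 → Fin 4 → K) →ₗ[K] (Fin 4 → MvPolynomial (Fin 4) K) :=
    LinearMap.pi fun i => (Fintype.linearCombination K (X : Fin 4 → MvPolynomial (Fin 4) K)) ∘ₗ
      LinearMap.proj i
  let μ : (Fin 4 → MvPolynomial (Fin 4) K) →ₗ[K] MvPolynomial (Fin 4) K :=
    ∑ i, (LinearMap.mulRight K (q i)) ∘ₗ LinearMap.proj i
  have hμ : ∀ v, μ v = ∑ i, v i * q i := by intro v; simp [μ]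
  let φ := μ ∘ₗ ψ
  -- the kernel has dimension at least m
  have hker : m ≤ Module.finrank K (LinearMap.ker φ) := by
    let c : Fin m → (Fin 4 → Fin 4 → K) := fun k i j =>
      MvPolynomial.coeff (Finsupp.single j 1) (V k i)
    have hc : ∀ k, ψ (c k) = V k := by
      intro k
      funext i
      rw [aux_linear (V k i) (hVhom k i)]
      simp [ψ, c, Fintype.linearCombination_apply]
    have hck : ∀ k, c k ∈ LinearMap.ker φ := by
      intro k
      rw [LinearMap.mem_ker]
      change μ (ψ (c k)) = 0
      rw [hc, hμ, hVsyz]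
    have hind : LinearIndependent K (fun k => (⟨c k, hck k⟩ : LinearMap.ker φ)) := by
      apply LinearIndependent.of_comp (ψ ∘ₗ (LinearMap.ker φ).subtype)
      convert hVind using 1
      funext k
      exact hc k
    simpa using hind.fintype_card_le_finrank
  have hrn := LinearMap.finrank_range_add_finrank_ker φ
  have h16 : Module.finrank K (Fin 4 → Fin 4 → K) = 16 := by
    simp [Module.finrank_pi_fintype]
  -- the range contains all products
  have hX : ∀ j, ∀ w ∈ Submodule.span K (Set.range q), X j * w ∈ LinearMap.range φ := by
    intro j w hw
    obtain ⟨a, rfl⟩ := (Submodule.mem_span_range_iff_exists_fun K).mp hw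
    refine ⟨fun i => Pi.single j (a i), ?_⟩
    change μ (ψ _) = _
    rw [hμ, Finset.mul_sum]
    refine Finset.sum_congr rfl fun i _ => ?_
    simp [ψ, Fintype.linearCombination_apply_single]
  let W := Submodule.span K (Set.range q)
  have hWhom : ∀ w ∈ W, w.IsHomogeneous 2 := by
    have : W ≤ homogeneousSubmodule (Fin 4) K 2 := by
      rw [Submodule.span_le]
      rintro _ ⟨i, rfl⟩
      exact hq i
    exact fun w hw => this hw
  have hWdeg : ∀ w ∈ W, w ≠ 0 → Finsupp.degree (o.degree w) = 2 := by
    intro w hw h0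
    have h1 := hWhom w hw (o.coeff_degree_ne_zero_iff.mpr h0)
    rw [Finsupp.degree_eq_weight_one]
    exact h1
  let D : Finset (Fin 4 →₀ ℕ) := (Finset.finsuppAntidiag Finset.univ 2).filter
    fun d => ∃ w ∈ W, w ≠ 0 ∧ o.degree w = d
  have hDcard : 4 ≤ D.card := by
    have h1 : Module.finrank K W = 4 := by
      simpa using finrank_span_eq_card hqind
    refine h1.symm.le.trans ?_
    apply aux_le o W D
    intro w hw h0
    refine Finset.mem_filter.mpr ⟨?_, w, hw, h0, rfl⟩
    rw [Finset.mem_finsuppAntidiag]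
    refine ⟨?_, Finset.subset_univ _⟩
    rw [← hWdeg w hw h0, Finsupp.degree_eq_sum]
  obtain ⟨T, hTD, hT⟩ := Finset.exists_subset_card_eq hDcard
  have hg := aux_growth T hT (by
    intro d hd
    have := (Finset.mem_finsuppAntidiag.mp (Finset.mem_filter.mp (hTD hd)).1).1
    simpa [Fin.sum_univ_four] using this)
  have hr := aux_ge o (LinearMap.range φ) (D := T.biUnion fun d =>
      Finset.univ.image fun i : Fin 4 => d + Finsupp.single i 1) (by
    intro e he
    simp only [Finset.mem_biUnion, Finset.mem_image, Finset.mem_univ, true_and] at he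
    obtain ⟨d, hd, i, rfl⟩ := he
    obtain ⟨w, hw, h0, rfl⟩ := (Finset.mem_filter.mp (hTD hd)).2
    refine ⟨X i * w, hX i w hw, mul_ne_zero (X_ne_zero i) h0, ?_⟩
    rw [o.degree_mul (X_ne_zero i) h0, o.degree_X, add_comm])
  omega
end

section
/- Let K be a field of characteristic zero, S = K[x_1,x_2,x_3,x_4], and let q_1,…,q_5 ∈ S be K-linearly independent quadrics. Then the K-vector space of linear syzygies {(l_1,…,l_5) ∈ (S_1)^5 : Σ_{i=1}^5 l_iq_i = 0} has dimension at most 7. -/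
open MvPolynomial

/-- Polynomials with pairwise distinct leading exponents are linearly independent. -/
theorem aux_linInd {K : Type*} [Field K] (mo : MonomialOrder (Fin 4)) {ι : Type*}
    (f : ι → MvPolynomial (Fin 4) K) (hf : ∀ i, f i ≠ 0)
    (hinj : Function.Injective fun i => mo.degree (f i)) : LinearIndependent K f := by
  classical
  rw [linearIndependent_iff']
  intro s g hg
  by_contra! hne
  obtain ⟨i0, hi0, hgi0⟩ := hne
  obtain ⟨i, hi, hmax⟩ := (s.filter fun i => g i ≠ 0).exists_max_image
    (fun i => mo.toSyn (mo.degree (f i))) ⟨i0, by simp [hi0, hgi0]⟩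
  rw [Finset.mem_filter] at hi
  have h := congrArg (coeff (mo.degree (f i))) hg
  rw [coeff_sum, Finset.sum_eq_single i] at h
  · simp only [coeff_smul, coeff_zero, smul_eq_mul, mul_eq_zero] at h
    rcases h with h | h
    · exact hi.2 h
    · exact mo.coeff_degree_ne_zero_iff.2 (hf i) h
  · intro j hj hji
    rw [coeff_smul]
    by_cases hgj : g j = 0
    · simp [hgj]
    · rw [mo.coeff_eq_zero_of_lt, smul_zero]
      refine lt_of_le_of_ne (hmax j (by simp [hj, hgj])) fun h => hji (hinj ?_)
      exact mo.toSyn.injective h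
  · exact fun h => absurd hi.1 h

/-- Numerical code of an exponent. -/
def auxCode (e : Fin 4 →₀ ℕ) : ℕ := e 0 + 4 * e 1 + 16 * e 2 + 64 * e 3

/-- Weights of the variables. -/
def auxW : Fin 4 → ℕ := ![1, 4, 16, 64]

/-- Codes of quadratic monomials. -/
def auxT : Finset ℕ := {2, 8, 32, 128, 5, 17, 65, 20, 68, 80}

theorem aux_count : ∀ B ∈ auxT.powersetCard 5,
    13 ≤ (B.biUnion fun b => Finset.univ.image fun j => b + auxW j).card := by
  decide +kernel

theorem aux_code_mem (e : Fin 4 →₀ ℕ) (h : e 0 + e 1 + e 2 + e 3 = 2) : auxCode e ∈ auxT := by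
  simp only [auxCode, auxT, Finset.mem_insert, Finset.mem_singleton]
  omega

theorem aux_code_inj (e e' : Fin 4 →₀ ℕ) (h : e 0 + e 1 + e 2 + e 3 = 2)
    (h' : e' 0 + e' 1 + e' 2 + e' 3 = 2) (hc : auxCode e = auxCode e') : e = e' := by
  simp only [auxCode] at hc
  have h3 : e 3 = e' 3 := by omega
  have h2 : e 2 = e' 2 := by omega
  have h1 : e 1 = e' 1 := by omega
  have h0 : e 0 = e' 0 := by omega
  ext i
  fin_cases i
  · exact h0
  · exact h1
  · exact h2
  · exact h3

theorem aux_code_add (j : Fin 4) (e : Fin 4 →₀ ℕ) :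
    auxCode (Finsupp.single j 1 + e) = auxCode e + auxW j := by
  fin_cases j <;> simp [auxCode, auxW] <;> ring

theorem aux_hom {K : Type*} [Field K] (p : MvPolynomial (Fin 4) K) (hp : p.IsHomogeneous 2)
    (e : Fin 4 →₀ ℕ) (he : coeff e p ≠ 0) : e 0 + e 1 + e 2 + e 3 = 2 := by
  have := hp he
  rw [Finsupp.weight_apply, Finsupp.sum_fintype _ _ (by simp)] at this
  simpa [Fin.sum_univ_four] using this

theorem aux_lin {K : Type*} [Field K] (p : MvPolynomial (Fin 4) K) (hp : p.IsHomogeneous 1) :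
    ∑ j, coeff (Finsupp.single j 1) p • (X j : MvPolynomial (Fin 4) K) = p := by
  classical
  ext e
  simp only [coeff_sum, coeff_smul, coeff_X, smul_eq_mul]
  by_cases he : coeff e p = 0
  · rw [he]
    refine Finset.sum_eq_zero fun j _ => ?_
    split_ifs with h
    · rw [h, he, zero_mul]
    · simp
  · have := hp he
    rw [Finsupp.weight_apply, Finsupp.sum_fintype _ _ (by simp)] at this
    have h1 : e 0 + e 1 + e 2 + e 3 = 1 := by simpa [Fin.sum_univ_four] using this
    have h2 : ∃ j, e j ≠ 0 := by
      by_contra! h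
      simp [h] at h1
    obtain ⟨j, hj⟩ := h2
    have h3 : e = Finsupp.single j 1 := by
      ext i
      fin_cases j <;> fin_cases i <;> simp [Finsupp.single_apply] at hj ⊢ <;> omega
    subst h3
    rw [Finset.sum_eq_single j]
    · simp
    · intro k _ hk
      rw [if_neg, mul_zero]
      intro h
      exact hk (Finsupp.single_left_injective one_ne_zero h)
    · simp

/-- for 5 linearly independent quadrics in `S = K[x₁,…,x₄]`
(`char K = 0`), the space of linear syzygies has dimension at most 7: every
linearly independent family of linear syzygies has at most 7 members. -/
theorem stmt10 (K : Type*) [Field K] [CharZero K]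
    (q : Fin 5 → MvPolynomial (Fin 4) K)
    (hq : ∀ i, (q i).IsHomogeneous 2) (hqind : LinearIndependent K q)
    (m : ℕ) (V : Fin m → (Fin 5 → MvPolynomial (Fin 4) K))
    (hVhom : ∀ k i, (V k i).IsHomogeneous 1)
    (hVsyz : ∀ k, ∑ i, V k i * q i = 0)
    (hVind : LinearIndependent K V) :
    m ≤ 7 := by
  classical
  let mo : MonomialOrder (Fin 4) := MonomialOrder.lex
  -- coefficient map for linear forms
  let lin : (Fin 5 → Fin 4 → K) →ₗ[K] (Fin 5 → MvPolynomial (Fin 4) K) :=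
    LinearMap.pi fun i => (Fintype.linearCombination K (X : Fin 4 → MvPolynomial (Fin 4) K)) ∘ₗ
      LinearMap.proj i
  have lin_apply : ∀ c i, lin c i = ∑ j, c i j • (X j : MvPolynomial (Fin 4) K) := by
    intro c i; simp [lin, Fintype.linearCombination_apply]
  let mul : (Fin 5 → MvPolynomial (Fin 4) K) →ₗ[K] MvPolynomial (Fin 4) K :=
    ∑ i, LinearMap.mulRight K (q i) ∘ₗ LinearMap.proj i
  have mul_apply : ∀ v, mul v = ∑ i, v i * q i := by
    intro v; simp [mul]
  let Φ := mul ∘ₗ lin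
  -- the combination map
  let comb : (Fin 5 → K) →ₗ[K] MvPolynomial (Fin 4) K := Fintype.linearCombination K q
  have comb_apply : ∀ c, comb c = ∑ i, c i • q i := fun c => Fintype.linearCombination_apply ..
  have comb_ne : ∀ c, c ≠ 0 → comb c ≠ 0 := by
    intro c hc h
    apply hc
    funext i
    exact Fintype.linearIndependent_iff.1 hqind c (by rw [← comb_apply]; exact h) i
  have comb_hom : ∀ c, (comb c).IsHomogeneous 2 := by
    intro c
    rw [comb_apply]
    refine IsHomogeneous.sum _ _ _ fun i _ => ?_
    exact (homogeneousSubmodule (Fin 4) K 2).smul_mem _ (hq i)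
  have deg2 : ∀ c, c ≠ 0 → mo.degree (comb c) 0 + mo.degree (comb c) 1 + mo.degree (comb c) 2 +
      mo.degree (comb c) 3 = 2 := fun c hc =>
    aux_hom _ (comb_hom c) _ (mo.coeff_degree_ne_zero_iff.2 (comb_ne c hc))
  let B : Finset ℕ := auxT.filter fun a => ∃ c, c ≠ 0 ∧ auxCode (mo.degree (comb c)) = a
  have hB : ∀ b : B, ∃ c, c ≠ 0 ∧ auxCode (mo.degree (comb c)) = b :=
    fun b => (Finset.mem_filter.1 b.2).2
  choose w hw0 hw using hB
  have hB5 : 5 ≤ B.card := by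
    let ψ : (Fin 5 → K) →ₗ[K] (B → K) :=
      LinearMap.pi fun b => lcoeff K (mo.degree (comb (w b))) ∘ₗ comb
    have hψ : Function.Injective ψ := by
      rw [← LinearMap.ker_eq_bot, LinearMap.ker_eq_bot']
      intro c hc
      by_contra hne
      let b : B := ⟨auxCode (mo.degree (comb c)),
        Finset.mem_filter.2 ⟨aux_code_mem _ (deg2 c hne), c, hne, rfl⟩⟩
      have h1 : mo.degree (comb (w b)) = mo.degree (comb c) :=
        aux_code_inj _ _ (deg2 _ (hw0 b)) (deg2 c hne) (hw b)
      have h2 : coeff (mo.degree (comb (w b))) (comb c) = 0 := congrFun hc b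
      rw [h1] at h2
      exact mo.coeff_degree_ne_zero_iff.2 (comb_ne c hne) h2
    simpa using LinearMap.finrank_le_finrank_of_injective hψ
  obtain ⟨B', hB'B, hB'5⟩ := Finset.exists_subset_card_eq hB5
  have hC := aux_count B' (Finset.mem_powersetCard.2
    ⟨hB'B.trans (Finset.filter_subset _ _), hB'5⟩)
  set C := B'.biUnion fun b => Finset.univ.image fun j => b + auxW j with hCdef
  have hu : ∀ x : C, ∃ u, Φ u ≠ 0 ∧ auxCode (mo.degree (Φ u)) = x := by
    rintro ⟨x, hx⟩
    simp only [hCdef, Finset.mem_biUnion, Finset.mem_image, Finset.mem_univ, true_and] at hx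
    obtain ⟨b, hb, j, rfl⟩ := hx
    let b' : B := ⟨b, hB'B hb⟩
    have key : Φ (fun i => Pi.single j (w b' i)) = X j * comb (w b') := by
      simp only [Φ, LinearMap.comp_apply, mul_apply, lin_apply, comb_apply, Finset.mul_sum]
      refine Finset.sum_congr rfl fun i _ => ?_
      rw [Finset.sum_eq_single j]
      · simp
      · intro k _ hk; simp [hk]
      · simp
    refine ⟨fun i => Pi.single j (w b' i), ?_, ?_⟩
    · rw [key]; exact mul_ne_zero (X_ne_zero j) (comb_ne _ (hw0 b'))
    · rw [key, mo.degree_mul (X_ne_zero j) (comb_ne _ (hw0 b')), mo.degree_X, aux_code_add, hw b']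
  choose u hu0 hu using hu
  have hrange : 13 ≤ Module.finrank K (LinearMap.range Φ) := by
    have hind : LinearIndependent K fun x : C => Φ (u x) := by
      refine aux_linInd mo _ hu0 fun x y hxy => ?_
      apply Subtype.ext
      rw [← hu x, ← hu y]
      exact congrArg auxCode hxy
    have hind' : LinearIndependent K fun x : C => (⟨Φ (u x), ⟨u x, rfl⟩⟩ : LinearMap.range Φ) :=
      LinearIndependent.of_comp (LinearMap.range Φ).subtype hind
    have := hind'.fintype_card_le_finrank
    simp only [Fintype.card_coe] at this
    omega
  let v : Fin m → (Fin 5 → Fin 4 → K) := fun k i j => coeff (Finsupp.single j 1) (V k i)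
  have hv : ∀ k, lin (v k) = V k := by
    intro k; funext i; rw [lin_apply]; exact aux_lin _ (hVhom k i)
  have hvind : LinearIndependent K v := by
    refine LinearIndependent.of_comp lin ?_
    have : (lin ∘ v) = V := funext hv
    rw [this]; exact hVind
  have hker : m ≤ Module.finrank K (LinearMap.ker Φ) := by
    have hind' : LinearIndependent K fun k => (⟨v k, by
        simp only [Φ, LinearMap.mem_ker, LinearMap.comp_apply, hv, mul_apply, hVsyz]⟩ :
          LinearMap.ker Φ) :=
      LinearIndependent.of_comp (LinearMap.ker Φ).subtype hvind
    simpa using hind'.fintype_card_le_finrank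
  have := Φ.finrank_range_add_finrank_ker
  have h20 : Module.finrank K (Fin 5 → Fin 4 → K) = 20 := by
    simp [Module.finrank_pi_fintype]
  omega
end
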